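/- arXiv:1706.01092 — 3 statements merged into one kernel-verified Lean document; each statement's English description precedes it below -/
import Mathlib

section
/- Let G be a group with lower central series Γ₁ = G, Γ_{i+1} = [G, Γ_i]. Let A, B be subgroups of Γ_j with B ∩ Γ_{j+1} trivial, let (h₁,…,h_l) be a generating tuple of A and (k₁,…,k_l) a generating tuple of B such that h_iΓ_{j+1} = k_iΓ_{j+1} for all i. Then for any x ∈ G: x⁻¹Ax = B if and only if x⁻¹h_ix = k_i for all i = 1,…,l. -/
/-- If `Γ` is the lower central series of `G` (1-indexed), `A, B ≤ Γ j`,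
`B ∩ Γ (j+1) = 1`, `(h i)` generates `A`, `(k i)` generates `B`, and
`h i ≡ k i mod Γ (j+1)` for all `i`, then for any `x ∈ G` we have
`x⁻¹ A x = B` iff `x⁻¹ (h i) x = k i` for all `i`. -/
theorem statement4 {G : Type*} [Group G] (Γ : ℕ → Subgroup G)
    (hΓ1 : Γ 1 = ⊤) (hΓ : ∀ i, 1 ≤ i → Γ (i + 1) = ⁅(⊤ : Subgroup G), Γ i⁆)
    (j : ℕ) (hj : 1 ≤ j) (A B : Subgroup G) (hA : A ≤ Γ j) (hB : B ≤ Γ j)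
    (htriv : B ⊓ Γ (j + 1) = ⊥)
    (l : ℕ) (h k : Fin l → G)
    (hgenA : Subgroup.closure (Set.range h) = A)
    (hgenB : Subgroup.closure (Set.range k) = B)
    (hcong : ∀ i, (h i)⁻¹ * k i ∈ Γ (j + 1)) :
    ∀ x : G,
      Subgroup.map (MulAut.conj x⁻¹).toMonoidHom A = B ↔
        ∀ i, x⁻¹ * h i * x = k i := by
  intro x
  constructor
  · intro hAB i
    have hiA : h i ∈ A := hgenA ▸ Subgroup.subset_closure ⟨i, rfl⟩
    have kiB : k i ∈ B := hgenB ▸ Subgroup.subset_closure ⟨i, rfl⟩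
    have h1 : x⁻¹ * h i * x ∈ B := by
      rw [← hAB]
      exact ⟨h i, hiA, by simp⟩
    have h2 : x⁻¹ * (h i)⁻¹ * (x⁻¹)⁻¹ * ((h i)⁻¹)⁻¹ ∈ Γ (j + 1) := by
      rw [hΓ j hj]
      exact Subgroup.commutator_mem_commutator (Subgroup.mem_top _) (inv_mem (hA hiA))
    have h3 : (x⁻¹ * h i * x)⁻¹ * k i ∈ B ⊓ Γ (j + 1) := by
      refine Subgroup.mem_inf.mpr ⟨mul_mem (inv_mem h1) kiB, ?_⟩
      have h4 := mul_mem h2 (hcong i)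
      have e : x⁻¹ * (h i)⁻¹ * (x⁻¹)⁻¹ * ((h i)⁻¹)⁻¹ * ((h i)⁻¹ * k i) = (x⁻¹ * h i * x)⁻¹ * k i := by
        group
      rw [e] at h4
      exact h4
    rw [htriv, Subgroup.mem_bot] at h3
    exact inv_mul_eq_one.mp h3
  · intro hx
    rw [← hgenA, ← hgenB, MonoidHom.map_closure, ← Set.range_comp]
    congr 2
    funext i
    simp [← hx i]
end

section
/- Let G be a group, N a normal subgroup of G with quotient map π: G → G/N, let H, K be subgroups of G and g₁, g₂ ∈ G. Let Λ = π⁻¹(π(H) ∩ π(K)) be the preimage in G of the intersection of the images of H and K. Suppose x₁ ∈ H and x₂ ∈ K satisfy π(g₁x₁) = π(g₂x₂), and set g' = g₁x₁ and c₀ = (g₁x₁)⁻¹g₂x₂ (so c₀ ∈ N). Then g₁H ∩ g₂K = g'(Λ ∩ H) ∩ g'c₀(Λ ∩ K). -/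
open Pointwise

/-- Let `N ⊴ G` with quotient map `π`, `H, K ≤ G`, `g₁, g₂ ∈ G`, and let
`Λ = π⁻¹(π(H) ∩ π(K))`.  If `x₁ ∈ H`, `x₂ ∈ K` satisfy `π(g₁x₁) = π(g₂x₂)`, then with
`g' = g₁x₁` and `c₀ = (g₁x₁)⁻¹g₂x₂` we have
`g₁H ∩ g₂K = g'(Λ ∩ H) ∩ g'c₀(Λ ∩ K)`. -/
theorem statement9 {G : Type*} [Group G] (N : Subgroup G) [N.Normal]
    (H K : Subgroup G) (g₁ g₂ x₁ x₂ : G) (hx₁ : x₁ ∈ H) (hx₂ : x₂ ∈ K)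
    (hπ : QuotientGroup.mk' N (g₁ * x₁) = QuotientGroup.mk' N (g₂ * x₂)) :
    (g₁ • (H : Set G)) ∩ (g₂ • (K : Set G)) =
      ((g₁ * x₁) •
          ((Subgroup.comap (QuotientGroup.mk' N)
                (Subgroup.map (QuotientGroup.mk' N) H ⊓
                  Subgroup.map (QuotientGroup.mk' N) K) ⊓ H : Subgroup G) : Set G)) ∩
        ((g₁ * x₁ * ((g₁ * x₁)⁻¹ * (g₂ * x₂))) •
          ((Subgroup.comap (QuotientGroup.mk' N)
                (Subgroup.map (QuotientGroup.mk' N) H ⊓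
                  Subgroup.map (QuotientGroup.mk' N) K) ⊓ K : Subgroup G) : Set G)) := by
  generalize QuotientGroup.mk' N = f at *
  rw [mul_inv_cancel_left]
  ext y
  have hH : (g₁ * x₁)⁻¹ * y ∈ H ↔ g₁⁻¹ * y ∈ H := by
    rw [mul_inv_rev, mul_assoc]
    exact H.mul_mem_cancel_left (H.inv_mem hx₁)
  have hK : (g₂ * x₂)⁻¹ * y ∈ K ↔ g₂⁻¹ * y ∈ K := by
    rw [mul_inv_rev, mul_assoc]
    exact K.mul_mem_cancel_left (K.inv_mem hx₂)
  have e : f ((g₁ * x₁)⁻¹ * y) = f ((g₂ * x₂)⁻¹ * y) := by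
    rw [map_mul, map_mul, map_inv, map_inv, hπ]
  simp only [Set.mem_inter_iff, Set.mem_smul_set_iff_inv_smul_mem, smul_eq_mul, SetLike.mem_coe,
    Subgroup.mem_inf, Subgroup.mem_comap]
  rw [hH, hK, ← e]
  constructor
  · rintro ⟨h1, h2⟩
    have m1 := Subgroup.mem_map_of_mem f (hH.2 h1)
    have m2 := Subgroup.mem_map_of_mem f (hK.2 h2)
    rw [← e] at m2
    exact ⟨⟨⟨m1, m2⟩, h1⟩, ⟨⟨m1, m2⟩, h2⟩⟩
  · rintro ⟨⟨_, h1⟩, ⟨_, h2⟩⟩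
    exact ⟨h1, h2⟩
end

section
/- Let G be a nilpotent group and H a subgroup of G. Then the isolator Is_G(H) = {g ∈ G | gⁿ ∈ H for some integer n ≠ 0} is a subgroup of G. -/
open scoped commutatorElement

/-- central elements with a positive power in `H`. -/
def isoCenter {G : Type*} [Group G] (H : Subgroup G) : Subgroup G where
  carrier := {z | z ∈ Subgroup.center G ∧ ∃ n : ℕ, 0 < n ∧ z ^ n ∈ H}
  one_mem' := ⟨one_mem _, 1, one_pos, by simp⟩
  mul_mem' := by
    rintro a b ⟨ha, n, hn, han⟩ ⟨hb, m, hm, hbm⟩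
    refine ⟨mul_mem ha hb, n * m, Nat.mul_pos hn hm, ?_⟩
    have hc : Commute a b := (Subgroup.mem_center_iff.1 hb a)
    rw [hc.mul_pow, pow_mul, mul_comm n m, pow_mul]
    exact mul_mem (pow_mem han _) (pow_mem hbm _)
  inv_mem' := by
    rintro a ⟨ha, n, hn, han⟩
    exact ⟨inv_mem ha, n, hn, by rw [inv_pow]; exact inv_mem han⟩

theorem iso_comm_mul_right {G : Type*} [Group G] (a b c : G)
    (h : ⁅a, c⁆ ∈ Subgroup.center G) : ⁅a, b * c⁆ = ⁅a, b⁆ * ⁅a, c⁆ := by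
  have h1 := Subgroup.mem_center_iff.1 h b
  have : ⁅a, b * c⁆ = ⁅a, b⁆ * (b * ⁅a, c⁆ * b⁻¹) := by
    simp only [commutatorElement_def]; group
  rw [this, h1]; group

theorem iso_comm_pow_right {G : Type*} [Group G] (a b : G)
    (h : ⁅a, b⁆ ∈ Subgroup.center G) (n : ℕ) : ⁅a, b ^ n⁆ = ⁅a, b⁆ ^ n := by
  induction n with
  | zero => simp
  | succ n ih => rw [pow_succ, iso_comm_mul_right _ _ _ h, ih, pow_succ]

theorem iso_comm_pow_left {G : Type*} [Group G] (a b : G)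
    (h : ⁅a, b⁆ ∈ Subgroup.center G) (n : ℕ) : ⁅a ^ n, b⁆ = ⁅a, b⁆ ^ n := by
  rw [← commutatorElement_inv b (a ^ n), iso_comm_pow_right b a, ← inv_pow, commutatorElement_inv]
  rw [← commutatorElement_inv]; exact inv_mem h

theorem iso_lemmaB {G : Type*} [Group G] (A H : Subgroup G) (X : Set G)
    (hX : Subgroup.closure X = ⊤)
    (hXH : ∀ x ∈ X, ∃ n : ℕ, 0 < n ∧ x ^ n ∈ H)
    (hA : ∀ a ∈ A, ∀ g : G, ⁅a, g⁆ ∈ Subgroup.center G)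
    (hAH : ∀ a ∈ A, ∃ n : ℕ, 0 < n ∧ ∃ h ∈ H, ∃ z ∈ Subgroup.center G, a ^ n = h * z) :
    ⁅A, (⊤ : Subgroup G)⁆ ≤ isoCenter H := by
  rw [Subgroup.commutator_le]
  intro a ha b _
  have hb : b ∈ Subgroup.closure X := by rw [hX]; trivial
  induction hb using Subgroup.closure_induction with
  | mem x hx =>
    refine ⟨hA a ha x, ?_⟩
    obtain ⟨m, hm, hxm⟩ := hXH x hx
    obtain ⟨n, hn, h, hh, z, hz, e⟩ := hAH a ha
    refine ⟨n * m, Nat.mul_pos hn hm, ?_⟩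
    have hz1 : z * x ^ m * z⁻¹ = x ^ m := by
      rw [← Subgroup.mem_center_iff.1 hz (x ^ m)]; group
    have e1 : ⁅h * z, x ^ m⁆ = ⁅h, x ^ m⁆ := by
      have : ⁅h * z, x ^ m⁆ = h * (z * x ^ m * z⁻¹) * h⁻¹ * (x ^ m)⁻¹ := by
        simp only [commutatorElement_def, mul_inv_rev, mul_assoc]
      rw [this, hz1, commutatorElement_def]
    have e2 : ⁅a, x⁆ ^ (n * m) = ⁅h, x ^ m⁆ := by
      rw [← e1, ← e, iso_comm_pow_right (a ^ n) x (hA _ (pow_mem ha n) x),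
        iso_comm_pow_left a x (hA a ha x), pow_mul]
    rw [e2, commutatorElement_def]
    exact mul_mem (mul_mem (mul_mem hh hxm) (inv_mem hh)) (inv_mem hxm)
  | one => simp [one_mem]
  | mul x y _ _ h1 h2 =>
    rw [iso_comm_mul_right _ _ _ (hA a ha y)]
    exact mul_mem (h1 trivial) (h2 trivial)
  | inv x _ h1 =>
    have h2 := iso_comm_mul_right a x x⁻¹ (hA a ha _)
    rw [mul_inv_cancel, commutatorElement_one_right] at h2
    rw [eq_inv_of_mul_eq_one_right h2.symm]
    exact inv_mem (h1 trivial)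

theorem iso_main (c : ℕ) : ∀ {G : Type*} [Group G] (H : Subgroup G) (X : Set G),
    (⊤ : Subgroup G).lowerCentralSeries c = ⊥ → Subgroup.closure X = ⊤ →
    (∀ x ∈ X, ∃ n : ℕ, 0 < n ∧ x ^ n ∈ H) → ∀ g : G, ∃ n : ℕ, 0 < n ∧ g ^ n ∈ H := by
  induction c with
  | zero =>
    intro G _ H X hc _ _ g
    have : g ∈ (⊥ : Subgroup G) := by rw [← hc]; trivial
    rw [Subgroup.mem_bot] at this
    exact ⟨1, one_pos, by simp [this, one_mem]⟩
  | succ c ih =>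
    intro G _ H X hc hX hXH g
    set N := (⊤ : Subgroup G).lowerCentralSeries c with hN
    have hcen : N ≤ Subgroup.center G := by
      intro z hz
      rw [Subgroup.mem_center_iff]
      intro y
      have : ⁅z, y⁆ ∈ (⊤ : Subgroup G).lowerCentralSeries (c + 1) := by
        rw [Subgroup.lowerCentralSeries_succ]
        exact Subgroup.commutator_mem_commutator hz (Subgroup.mem_top _)
      rw [hc, Subgroup.mem_bot, commutatorElement_eq_one_iff_mul_comm] at this
      exact this.symm
    have key : ∀ g : G, ∃ n : ℕ, 0 < n ∧ ∃ h ∈ H, ∃ z ∈ N, g ^ n = h * z := by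
      intro g
      obtain ⟨n, hn, h, hh, e⟩ := ih (G := G ⧸ N) (H.map (QuotientGroup.mk' N))
        (QuotientGroup.mk' N '' X) (by
          have h1 := Subgroup.map_lowerCentralSeries (S := (⊤ : Subgroup G))
            (QuotientGroup.mk' N) c
          rw [Subgroup.map_top_of_surjective _ (QuotientGroup.mk'_surjective N)] at h1
          rw [← h1, ← hN, QuotientGroup.map_mk'_self])
        (by
          rw [← MonoidHom.map_closure, hX,
            Subgroup.map_top_of_surjective _ (QuotientGroup.mk'_surjective N)])
        (by
          rintro _ ⟨x, hx, rfl⟩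
          obtain ⟨n, hn, hxn⟩ := hXH x hx
          exact ⟨n, hn, by rw [← map_pow]; exact Subgroup.mem_map_of_mem _ hxn⟩)
        (QuotientGroup.mk' N g)
      refine ⟨n, hn, h, hh, h⁻¹ * g ^ n, ?_, by group⟩
      rw [← map_pow] at e
      exact QuotientGroup.eq.1 e
    have hNS : N ≤ isoCenter H := by
      cases c with
      | zero =>
        have hc' : ∀ z : G, z ∈ Subgroup.center G := fun z => hcen trivial
        have : Subgroup.closure X ≤ isoCenter H := by
          rw [Subgroup.closure_le]
          exact fun x hx => ⟨hc' x, hXH x hx⟩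
        exact le_trans le_top (hX ▸ this)
      | succ d =>
        rw [hN, Subgroup.lowerCentralSeries_succ]
        refine iso_lemmaB _ H X hX hXH ?_ ?_
        · intro a ha g
          apply hcen
          rw [hN, Subgroup.lowerCentralSeries_succ]
          exact Subgroup.commutator_mem_commutator ha (Subgroup.mem_top _)
        · intro a _
          obtain ⟨n, hn, h, hh, z, hz, e⟩ := key a
          exact ⟨n, hn, h, hh, z, hcen hz, e⟩
    obtain ⟨n, hn, h, hh, z, hz, e⟩ := key g
    obtain ⟨hz1, k, hk, hzk⟩ := hNS hz
    refine ⟨n * k, Nat.mul_pos hn hk, ?_⟩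
    have hcm : Commute h z := Subgroup.mem_center_iff.1 hz1 h
    rw [pow_mul, e, hcm.mul_pow]
    exact mul_mem (pow_mem hh _) hzk

theorem iso_nat {G : Type*} [Group G] (H : Subgroup G) (g : G) :
    (∃ n : ℤ, n ≠ 0 ∧ g ^ n ∈ H) ↔ ∃ n : ℕ, 0 < n ∧ g ^ n ∈ H := by
  constructor
  · rintro ⟨n, hn, h⟩
    refine ⟨n.natAbs, Int.natAbs_pos.2 hn, ?_⟩
    rw [← zpow_natCast]
    rcases Int.natAbs_eq n with e | e
    · rwa [← e]
    · rw [e, zpow_neg] at h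
      exact inv_mem_iff.1 h
  · rintro ⟨n, hn, h⟩
    exact ⟨n, by omega, by rwa [zpow_natCast]⟩

/-- In a nilpotent group `G`, the isolator
`Is_G(H) = {g ∈ G | gⁿ ∈ H for some n ≠ 0}` of a subgroup `H` is a subgroup. -/
theorem statement18 {G : Type*} [Group G] [Group.IsNilpotent G] (H : Subgroup G) :
    ∃ S : Subgroup G, (S : Set G) = {g : G | ∃ n : ℤ, n ≠ 0 ∧ g ^ n ∈ H} := by
  simp only [iso_nat]
  let X : Set G := {g : G | ∃ n : ℕ, 0 < n ∧ g ^ n ∈ H}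
  refine ⟨Subgroup.closure X, Set.Subset.antisymm ?_ Subgroup.subset_closure⟩
  intro g hg
  let K := Subgroup.closure X
  obtain ⟨c, hc⟩ := (Subgroup.nilpotent_iff_lowerCentralSeries (G := K)).1 inferInstance
  obtain ⟨n, hn, h⟩ := iso_main c (H.subgroupOf K) (((↑) : K → G) ⁻¹' X) hc
    (Subgroup.closure_closure_coe_preimage)
    (by
      rintro x ⟨n, hn, h⟩
      exact ⟨n, hn, by simpa [Subgroup.mem_subgroupOf] using h⟩) ⟨g, hg⟩
  exact ⟨n, hn, by simpa [Subgroup.mem_subgroupOf] using h⟩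
end
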